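/- Let K be a field of characteristic different from 2. Then the quotient of the Milnor-Witt K-theory K^MW_*(K) by the two-sided ideal generated by all symbols [λ], λ ∈ K^×, is isomorphic as a graded ring to ℤ[η]/(2η) (with η in degree −1), via the map sending η to η and every [λ] to 0. -/

import Mathlib

/-!
Milnor-Witt K-theory of a field `K`, presented as the quotient of the free
(associative, unital) `ℤ`-algebra on generators `[a]` (for `a ∈ Kˣ`, degree 1)
and `η` (degree `-1`) by the Milnor-Witt relations.
-/

namespace MWStatement

variable (K : Type) [Field K]

/-- The free `ℤ`-algebra on the generators of Milnor-Witt K-theory: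
`none` stands for `η` and `some a` for the symbol `[a]`, `a ∈ Kˣ`. -/
abbrev Pre := FreeAlgebra ℤ (Option Kˣ)

/-- The generator `η`. -/
noncomputable def preEta : Pre K := FreeAlgebra.ι ℤ (none : Option Kˣ)

/-- The symbol `[a]` for a unit `a`. -/
noncomputable def preSym (a : Kˣ) : Pre K := FreeAlgebra.ι ℤ (some a)

/-- The defining relations of Milnor-Witt K-theory. -/
inductive Rel : Pre K → Pre K → Prop
  | steinberg (a : Kˣ) (h : (a : K) ≠ 1) :
      Rel (preSym K a * preSym K (Units.mk0 (1 - (a : K)) (sub_ne_zero_of_ne (Ne.symm h)))) 0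
  | mulSym (a b : Kˣ) :
      Rel (preSym K (a * b)) (preSym K a + preSym K b + preEta K * preSym K a * preSym K b)
  | etaComm (a : Kˣ) : Rel (preEta K * preSym K a) (preSym K a * preEta K)
  | hyperbolic : Rel (preEta K * ((2 : Pre K) + preEta K * preSym K (-1))) 0

/-- Milnor-Witt K-theory `K^MW_*(K)` (as a ring, forgetting the grading). -/
abbrev KMW := RingQuot (Rel K)

/-- The class of `η` in Milnor-Witt K-theory. -/
noncomputable def eta : KMW K := RingQuot.mkRingHom (Rel K) (preEta K)

/-- The class of the symbol `[a]` in Milnor-Witt K-theory. -/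
noncomputable def sym (a : Kˣ) : KMW K := RingQuot.mkRingHom (Rel K) (preSym K a)


/-- The ring `ℤ[η]/(2η)`: the polynomial ring `ℤ[η]` modulo the ideal generated by `2η`. -/
abbrev ZEta := Polynomial ℤ ⧸ (Ideal.span {(2 : Polynomial ℤ) * Polynomial.X})

/-- The class of `η` in `ℤ[η]/(2η)`. -/
noncomputable def etaZ : ZEta := Ideal.Quotient.mk _ Polynomial.X

/-- The two-sided ideal of `K^MW_*(K)` generated by all symbols `[λ]`, `λ ∈ Kˣ`. -/
noncomputable def symIdeal : TwoSidedIdeal (KMW K) :=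
  TwoSidedIdeal.span {x : KMW K | ∃ a : Kˣ, x = sym K a}

/-- The quotient of `K^MW_*(K)` by the two-sided ideal generated by the symbols. -/
abbrev SymQuot := (symIdeal K).ringCon.Quotient

/-- The quotient map `K^MW_*(K) → K^MW_*(K)/([λ] : λ ∈ Kˣ)`. -/
noncomputable def symQuotMk : KMW K →+* SymQuot K := (symIdeal K).ringCon.mk'

end MWStatement

namespace MWStatement

theorem two_mul_etaZ : (2 : ZEta) * etaZ = 0 := by
  have h : (Ideal.Quotient.mk (Ideal.span {(2 : Polynomial ℤ) * Polynomial.X}))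
      (2 * Polynomial.X) = 0 :=
    Ideal.Quotient.eq_zero_iff_mem.2 (Ideal.subset_span rfl)
  rwa [map_mul, map_ofNat] at h

section

variable (K : Type) [Field K]

/-- The ring homomorphism from the free algebra sending `η` to `η` and all symbols to `0`. -/
noncomputable def preToZEta : Pre K →+* ZEta :=
  (FreeAlgebra.lift ℤ (fun o : Option Kˣ => o.elim etaZ fun _ => 0)).toRingHom

@[simp]
theorem preToZEta_preEta : preToZEta K (preEta K) = etaZ := by
  simp [preToZEta, preEta]

@[simp]
theorem preToZEta_preSym (a : Kˣ) : preToZEta K (preSym K a) = 0 := by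
  simp [preToZEta, preSym]

theorem preToZEta_rel ⦃x y : Pre K⦄ (h : Rel K x y) : preToZEta K x = preToZEta K y := by
  cases h with
  | hyperbolic =>
    simp only [map_mul, map_add, map_ofNat, preToZEta_preEta, preToZEta_preSym, mul_zero,
      add_zero, map_zero]
    rw [mul_comm, two_mul_etaZ]
  | _ => simp

/-- The ring homomorphism `K^MW_*(K) → ℤ[η]/(2η)` sending `η` to `η` and all symbols to `0`. -/
noncomputable def toZEta : KMW K →+* ZEta :=
  RingQuot.lift ⟨preToZEta K, preToZEta_rel K⟩

@[simp]
theorem toZEta_eta : toZEta K (eta K) = etaZ := by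
  simp [toZEta, eta]

@[simp]
theorem toZEta_sym (a : Kˣ) : toZEta K (sym K a) = 0 := by
  simp [toZEta, sym]

theorem symIdeal_le_ker : (symIdeal K).ringCon ≤ RingCon.ker (toZEta K) := by
  have h : symIdeal K ≤ TwoSidedIdeal.ker (toZEta K) := by
    rw [symIdeal, TwoSidedIdeal.span_le]
    rintro x ⟨a, rfl⟩
    simp [TwoSidedIdeal.mem_ker]
  intro x y hxy
  have hm := h ((TwoSidedIdeal.rel_iff _ x y).1 hxy)
  rw [TwoSidedIdeal.mem_ker, map_sub, sub_eq_zero] at hm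
  exact hm

/-- The induced ring homomorphism from the quotient by the symbols to `ℤ[η]/(2η)`. -/
noncomputable def symQuotToZEta : SymQuot K →+* ZEta :=
  RingCon.lift (symIdeal K).ringCon (toZEta K) (symIdeal_le_ker K)

@[simp]
theorem symQuotToZEta_mk (x : KMW K) : symQuotToZEta K (symQuotMk K x) = toZEta K x :=
  rfl

@[simp]
theorem symQuotMk_sym (a : Kˣ) : symQuotMk K (sym K a) = 0 := by
  have h : sym K a ∈ symIdeal K := TwoSidedIdeal.subset_span ⟨a, rfl⟩
  rw [TwoSidedIdeal.mem_iff] at h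
  exact (RingCon.eq _).2 h

theorem two_mul_symQuotMk_eta : (2 : SymQuot K) * symQuotMk K (eta K) = 0 := by
  have h := congrArg (symQuotMk K) (RingQuot.mkRingHom_rel (Rel.hyperbolic (K := K)))
  have hs : symQuotMk K (RingQuot.mkRingHom (Rel K) (preSym K (-1))) = 0 := symQuotMk_sym K (-1)
  simp only [map_mul, map_add, map_ofNat, map_zero, hs, mul_zero, add_zero] at h
  rw [two_mul, ← mul_two]
  exact h

/-- The ring homomorphism `ℤ[η] → K^MW_*(K)/([λ])` sending `η` to `η`. -/
noncomputable def polyToSymQuot : Polynomial ℤ →+* SymQuot K :=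
  Polynomial.eval₂RingHom' (Int.castRingHom _) (symQuotMk K (eta K))
    fun n => Int.cast_commute n _

@[simp]
theorem polyToSymQuot_X : polyToSymQuot K Polynomial.X = symQuotMk K (eta K) := by
  simp [polyToSymQuot]

/-- The induced ring homomorphism `ℤ[η]/(2η) → K^MW_*(K)/([λ])`. -/
noncomputable def ofZEta : ZEta →+* SymQuot K :=
  Ideal.Quotient.lift _ (polyToSymQuot K) fun x hx => by
    obtain ⟨y, rfl⟩ := Ideal.mem_span_singleton'.1 hx
    rw [map_mul, map_mul, map_ofNat, polyToSymQuot_X, two_mul_symQuotMk_eta, mul_zero]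

@[simp]
theorem ofZEta_etaZ : ofZEta K etaZ = symQuotMk K (eta K) := by
  simp [ofZEta, etaZ]

theorem symQuotToZEta_comp_ofZEta : (symQuotToZEta K).comp (ofZEta K) = RingHom.id ZEta := by
  refine Ideal.Quotient.ringHom_ext (Polynomial.ringHom_ext (fun n => by simp) ?_)
  change symQuotToZEta K (ofZEta K etaZ) = etaZ
  simp

theorem ofZEta_comp_symQuotToZEta :
    (ofZEta K).comp (symQuotToZEta K) = RingHom.id (SymQuot K) := by
  have key (x : Pre K) : ofZEta K (toZEta K (RingQuot.mkRingHom (Rel K) x)) =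
      symQuotMk K (RingQuot.mkRingHom (Rel K) x) := by
    induction x using FreeAlgebra.induction with
    | grade0 n => simp
    | grade1 o =>
      cases o with
      | none =>
        change ofZEta K (toZEta K (eta K)) = symQuotMk K (eta K)
        simp
      | some a =>
        change ofZEta K (toZEta K (sym K a)) = symQuotMk K (sym K a)
        simp
    | mul x y hx hy => simp only [map_mul, hx, hy]
    | add x y hx hy => simp only [map_add, hx, hy]
  refine RingHom.ext fun x => ?_
  obtain ⟨x, rfl⟩ := RingCon.mk'_surjective _ x
  obtain ⟨x, rfl⟩ := RingQuot.mkRingHom_surjective _ x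
  exact key x

end

end MWStatement

open MWStatement in
/-- Let `K` be a field of characteristic `≠ 2`.  The quotient of the
Milnor-Witt K-theory `K^MW_*(K)` by the two-sided ideal generated by all symbols `[λ]`,
`λ ∈ Kˣ`, is isomorphic as a ring to `ℤ[η]/(2η)`, via the map sending `η` to `η` and
every `[λ]` to `0`. -/
theorem statement13 (K : Type) [Field K] (hchar : (2 : K) ≠ 0) :
    ∃ e : SymQuot K ≃+* ZEta,
      e (symQuotMk K (eta K)) = etaZ ∧ ∀ a : Kˣ, e (symQuotMk K (sym K a)) = 0 := by
  exact ⟨RingEquiv.ofRingHom (symQuotToZEta K) (ofZEta K) (symQuotToZEta_comp_ofZEta K)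
    (ofZEta_comp_symQuotToZEta K), toZEta_eta K, toZEta_sym K⟩
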